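/- Let N be a positive integer, Λ ∈ GL(N,ℝ), and let G be a smooth harmonic-Einstein map from ℝ to the symmetric positive-definite real N×N matrices such that G and G' both satisfy the Λ-holonomy boundary condition. Let h be a smooth map from ℝ to the symmetric real N×N matrices such that h and h' both satisfy the Λ-holonomy boundary condition. Then ∫₀¹ ⟨(L₂h)(ξ), h(ξ)⟩_{G(ξ)} dξ ≤ 0, and equality holds if and only if the map ξ ↦ G(ξ)⁻¹ h(ξ) is constant on [0,1]. -/

import Mathlib

open Matrix

/-- The fiberwise inner product `⟨φ,ψ⟩_G = tr(G⁻¹ φ G⁻¹ ψᵀ)`. -/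
noncomputable def innerG {N : ℕ} (G φ ψ : Matrix (Fin N) (Fin N) ℝ) : ℝ :=
  (G⁻¹ * φ * G⁻¹ * ψᵀ).trace

/-- The Λ-holonomy boundary condition `φ(1) = Λᵀ φ(0) Λ`. -/
def holBC {N : ℕ} (Λ : Matrix (Fin N) (Fin N) ℝ)
    (φ : ℝ → Matrix (Fin N) (Fin N) ℝ) : Prop :=
  φ 1 = Λᵀ * φ 0 * Λ

/-- The operator `L₂` associated to a fiber metric `G` (with derivative `G'`),
acting on `h` with derivatives `h'`, `h''`. -/
noncomputable def L2 {N : ℕ} (G G' h h' h'' : ℝ → Matrix (Fin N) (Fin N) ℝ)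
    (ξ : ℝ) : Matrix (Fin N) (Fin N) ℝ :=
  h'' ξ - h' ξ * (G ξ)⁻¹ * G' ξ - G' ξ * (G ξ)⁻¹ * h' ξ
    + G' ξ * (G ξ)⁻¹ * h ξ * (G ξ)⁻¹ * G' ξ

section MatrixCalculus

attribute [local instance] Matrix.linftyOpNormedRing Matrix.linftyOpNormedAlgebra

variable {N : ℕ}

/-- A matrix-valued function whose entries are differentiable is differentiable. -/
theorem hasDerivAt_matrix {A : ℝ → Matrix (Fin N) (Fin N) ℝ} {A' : Matrix (Fin N) (Fin N) ℝ}
    {ξ : ℝ} (hA : ∀ i j, HasDerivAt (fun t => A t i j) (A' i j) ξ) : HasDerivAt A A' ξ :=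
  hasDerivAt_pi.2 fun i => hasDerivAt_pi.2 fun j => hA i j

theorem HasDerivAt.matrix_inv {A : ℝ → Matrix (Fin N) (Fin N) ℝ}
    {A' : Matrix (Fin N) (Fin N) ℝ} {ξ : ℝ} (hA : HasDerivAt A A' ξ) (hu : IsUnit (A ξ)) :
    HasDerivAt (fun t => (A t)⁻¹) (-((A ξ)⁻¹ * A' * (A ξ)⁻¹)) ξ := by
  obtain ⟨u, hu⟩ := hu
  have hinv : HasFDerivAt Ring.inverse _ (A ξ) := hu ▸ hasFDerivAt_ringInverse (𝕜 := ℝ) u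
  have hcomp := hinv.comp_hasDerivAt ξ hA
  have hfun : (fun t => (A t)⁻¹) = Ring.inverse ∘ A :=
    funext fun t => Matrix.nonsing_inv_eq_ringInverse (A t)
  have hval : -((A ξ)⁻¹ * A' * (A ξ)⁻¹) =
      (-ContinuousLinearMap.mulLeftRight ℝ (Matrix (Fin N) (Fin N) ℝ) ↑u⁻¹ ↑u⁻¹) A' := by
    simp [← hu, Matrix.coe_units_inv]
  rw [hfun, hval]
  exact hcomp

theorem HasDerivAt.matrix_mul {A B : ℝ → Matrix (Fin N) (Fin N) ℝ}
    {A' B' : Matrix (Fin N) (Fin N) ℝ} {ξ : ℝ} (hA : HasDerivAt A A' ξ)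
    (hB : HasDerivAt B B' ξ) :
    HasDerivAt (fun t => A t * B t) (A' * B ξ + A ξ * B') ξ :=
  hA.mul hB

theorem HasDerivAt.matrix_sub {A B : ℝ → Matrix (Fin N) (Fin N) ℝ}
    {A' B' : Matrix (Fin N) (Fin N) ℝ} {ξ : ℝ} (hA : HasDerivAt A A' ξ)
    (hB : HasDerivAt B B' ξ) :
    HasDerivAt (fun t => A t - B t) (A' - B') ξ :=
  hA.sub hB

theorem HasDerivAt.matrix_trace {A : ℝ → Matrix (Fin N) (Fin N) ℝ}
    {A' : Matrix (Fin N) (Fin N) ℝ} {ξ : ℝ} (hA : HasDerivAt A A' ξ) :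
    HasDerivAt (fun t => (A t).trace) A'.trace ξ :=
  HasDerivAt.fun_sum fun i _ => hasDerivAt_pi.1 (hasDerivAt_pi.1 hA i) i

theorem HasDerivAt.matrix_isSymm {A : ℝ → Matrix (Fin N) (Fin N) ℝ}
    {A' : Matrix (Fin N) (Fin N) ℝ} {ξ : ℝ} (hA : HasDerivAt A A' ξ)
    (hsymm : ∀ t, (A t).IsSymm) : A'.IsSymm := by
  ext i j
  have hij := hasDerivAt_pi.1 (hasDerivAt_pi.1 hA i) j
  have hji := hasDerivAt_pi.1 (hasDerivAt_pi.1 hA j) i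
  simp only [fun t => (hsymm t).apply i j] at hji
  exact hji.unique hij

theorem HasDerivAt.matrix_continuousAt {A : ℝ → Matrix (Fin N) (Fin N) ℝ}
    {A' : Matrix (Fin N) (Fin N) ℝ} {ξ : ℝ} (hA : HasDerivAt A A' ξ) : ContinuousAt A ξ :=
  hA.continuousAt

/-- A differentiable matrix-valued function is constant on `[0, 1]` exactly when its derivative
vanishes there. -/
theorem matrix_const_on_Icc_iff {A A' : ℝ → Matrix (Fin N) (Fin N) ℝ}
    (hA : ∀ ξ, HasDerivAt A (A' ξ) ξ) :
    (∀ ξ ∈ Set.Icc (0:ℝ) 1, A ξ = A 0) ↔ ∀ ξ ∈ Set.Icc (0:ℝ) 1, A' ξ = 0 := by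
  constructor
  · intro hconst ξ hξ
    have hzero : HasDerivWithinAt A 0 (Set.Icc 0 1) ξ :=
      (hasDerivWithinAt_const ξ (Set.Icc (0:ℝ) 1) (A 0)).congr hconst (hconst ξ hξ)
    exact (uniqueDiffOn_Icc zero_lt_one ξ hξ).eq_deriv _ (hA ξ).hasDerivWithinAt hzero
  · intro hzero
    refine constant_of_has_deriv_right_zero (fun ξ _ => (hA ξ).continuousAt.continuousWithinAt)
      fun ξ hξ => ?_
    rw [← hzero ξ ⟨hξ.1, hξ.2.le⟩]
    exact (hA ξ).hasDerivWithinAt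

end MatrixCalculus

section InnerG

open scoped MatrixOrder Matrix.Norms.L2Operator

variable {N : ℕ} {G : Matrix (Fin N) (Fin N) ℝ}

/-- The inverse of a positive definite matrix has an invertible Gram factor, in which
`‖φ‖_G²` is a sum of squares. -/
theorem exists_innerG_self_eq (hG : G.PosDef) : ∃ B : Matrix (Fin N) (Fin N) ℝ, IsUnit B ∧
    ∀ φ, innerG G φ φ = ((B * φ * Bᵀ) * (B * φ * Bᵀ)ᴴ).trace := by
  obtain ⟨B, hB, hGB⟩ : ∃ B : Matrix (Fin N) (Fin N) ℝ, IsUnit B ∧ G⁻¹ = star B * B :=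
    CStarAlgebra.isStrictlyPositive_iff_eq_star_mul_self.1 hG.inv.isStrictlyPositive
  refine ⟨B, hB, fun φ => ?_⟩
  rw [innerG, hGB, Matrix.star_eq_conjTranspose]
  simp only [Matrix.conjTranspose_eq_transpose_of_trivial, Matrix.transpose_mul,
    Matrix.transpose_transpose, Matrix.mul_assoc]
  rw [Matrix.trace_mul_comm]
  simp only [Matrix.mul_assoc]

theorem innerG_self_nonneg (hG : G.PosDef) (φ : Matrix (Fin N) (Fin N) ℝ) :
    0 ≤ innerG G φ φ := by
  obtain ⟨B, -, hB⟩ := exists_innerG_self_eq hG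
  rw [hB]
  exact (Matrix.posSemidef_self_mul_conjTranspose _).trace_nonneg

theorem innerG_self_eq_zero (hG : G.PosDef) {φ : Matrix (Fin N) (Fin N) ℝ} :
    innerG G φ φ = 0 ↔ φ = 0 := by
  obtain ⟨B, hBu, hB⟩ := exists_innerG_self_eq hG
  rw [hB, Matrix.trace_mul_conjTranspose_self_eq_zero_iff,
    ((Matrix.isUnit_transpose B).2 hBu).mul_left_eq_zero, hBu.mul_right_eq_zero]

/-- Invariance of the inner product under a change of frame. -/
theorem innerG_congr {Λ : Matrix (Fin N) (Fin N) ℝ} (hΛ : IsUnit Λ)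
    (φ ψ : Matrix (Fin N) (Fin N) ℝ) :
    innerG (Λᵀ * G * Λ) (Λᵀ * φ * Λ) (Λᵀ * ψ * Λ) = innerG G φ ψ := by
  have hd : IsUnit Λ.det := (Matrix.isUnit_iff_isUnit_det Λ).1 hΛ
  have hdt : IsUnit Λᵀ.det := by rwa [Matrix.det_transpose]
  simp only [innerG, Matrix.mul_inv_rev, Matrix.transpose_mul, Matrix.transpose_transpose,
    Matrix.mul_assoc, Matrix.nonsing_inv_mul_cancel_left _ _ hdt,
    Matrix.mul_nonsing_inv_cancel_left _ _ hd]
  rw [Matrix.trace_mul_comm]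
  simp only [Matrix.mul_assoc, Matrix.mul_nonsing_inv _ hd, Matrix.mul_one]

end InnerG

/-- The covariant derivative `h' - G' G⁻¹ h = G (G⁻¹ h)'`. -/
noncomputable def covDeriv {N : ℕ} (G G' h h' : ℝ → Matrix (Fin N) (Fin N) ℝ) (ξ : ℝ) :
    Matrix (Fin N) (Fin N) ℝ :=
  h' ξ - G' ξ * (G ξ)⁻¹ * h ξ

section CovDeriv

variable {N : ℕ} {G G' G'' h h' h'' : ℝ → Matrix (Fin N) (Fin N) ℝ} {ξ : ℝ}

theorem hasDerivAt_inv_mul (hG : HasDerivAt G (G' ξ) ξ) (hpos : (G ξ).PosDef)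
    (hh : HasDerivAt h (h' ξ) ξ) :
    HasDerivAt (fun t => (G t)⁻¹ * h t) ((G ξ)⁻¹ * covDeriv G G' h h' ξ) ξ := by
  convert (hG.matrix_inv hpos.isUnit).matrix_mul hh using 1
  rw [covDeriv]
  noncomm_ring

/-- `L₂h = (Dh)' - (Dh) G⁻¹ G'` for the covariant derivative `D`. -/
theorem hasDerivAt_covDeriv (hG : HasDerivAt G (G' ξ) ξ) (hG' : HasDerivAt G' (G'' ξ) ξ)
    (hpos : (G ξ).PosDef) (hHE : G'' ξ = G' ξ * (G ξ)⁻¹ * G' ξ)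
    (hh : HasDerivAt h (h' ξ) ξ) (hh' : HasDerivAt h' (h'' ξ) ξ) :
    HasDerivAt (covDeriv G G' h h')
      (L2 G G' h h' h'' ξ + covDeriv G G' h h' ξ * (G ξ)⁻¹ * G' ξ) ξ := by
  have hderiv := hh'.matrix_sub ((hG'.matrix_mul (hG.matrix_inv hpos.isUnit)).matrix_mul hh)
  change HasDerivAt (fun t => h' t - G' t * (G t)⁻¹ * h t) _ ξ
  convert hderiv using 1
  rw [hHE, covDeriv, L2]
  noncomm_ring

theorem hasDerivAt_innerG_covDeriv (hG : HasDerivAt G (G' ξ) ξ)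
    (hG' : HasDerivAt G' (G'' ξ) ξ) (hpos : ∀ t, (G t).PosDef)
    (hHE : G'' ξ = G' ξ * (G ξ)⁻¹ * G' ξ) (hh : HasDerivAt h (h' ξ) ξ)
    (hh' : HasDerivAt h' (h'' ξ) ξ) (hsymm : ∀ t, (h t).IsSymm) :
    HasDerivAt (fun t => innerG (G t) (covDeriv G G' h h' t) (h t))
      (innerG (G ξ) (L2 G G' h h' h'' ξ) (h ξ)
        + innerG (G ξ) (covDeriv G G' h h' ξ) (covDeriv G G' h h' ξ)) ξ := by
  have hGsymm : ∀ t, (G t).IsSymm := fun t => by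
    simpa [Matrix.IsHermitian, Matrix.IsSymm] using (hpos t).isHermitian
  have hG'symm := hG.matrix_isSymm hGsymm
  have hh'symm := hh.matrix_isSymm hsymm
  have hinv := hG.matrix_inv (hpos ξ).isUnit
  have hcov := hasDerivAt_covDeriv hG hG' (hpos ξ) hHE hh hh'
  have hcovT : (covDeriv G G' h h' ξ)ᵀ = h' ξ - h ξ * (G ξ)⁻¹ * G' ξ := by
    rw [covDeriv, Matrix.transpose_sub, Matrix.transpose_mul, Matrix.transpose_mul,
      Matrix.transpose_nonsing_inv, (hGsymm ξ).eq, hG'symm.eq, hh'symm.eq, (hsymm ξ).eq,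
      Matrix.mul_assoc]
  have hderiv := (((hinv.matrix_mul hcov).matrix_mul hinv).matrix_mul hh).matrix_trace
  simp only [innerG, hcovT, (hsymm _).eq]
  convert hderiv using 1
  generalize covDeriv G G' h h' ξ = k
  generalize L2 G G' h h' h'' ξ = l
  have hcyc : ((G ξ)⁻¹ * k * (G ξ)⁻¹ * (h ξ * (G ξ)⁻¹ * G' ξ)).trace
      = ((G ξ)⁻¹ * G' ξ * (G ξ)⁻¹ * k * (G ξ)⁻¹ * h ξ).trace := by
    rw [← Matrix.mul_assoc, ← Matrix.mul_assoc, Matrix.mul_assoc, Matrix.trace_mul_comm]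
    simp only [Matrix.mul_assoc]
  rw [Matrix.mul_sub, Matrix.trace_sub, hcyc, ← Matrix.trace_sub, ← Matrix.trace_add]
  congr 1
  noncomm_ring

end CovDeriv

theorem continuous_innerG {N : ℕ} {G φ ψ : ℝ → Matrix (Fin N) (Fin N) ℝ}
    (hG : Continuous fun ξ => (G ξ)⁻¹) (hφ : Continuous φ) (hψ : Continuous ψ) :
    Continuous fun ξ => innerG (G ξ) (φ ξ) (ψ ξ) :=
  (((hG.matrix_mul hφ).matrix_mul hG).matrix_mul hψ.matrix_transpose).matrix_trace

/-- The second derivative of a smooth function is continuous. -/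
theorem continuous_second_deriv {f f' f'' : ℝ → ℝ} (hf : ContDiff ℝ (⊤ : ℕ∞) f)
    (hf' : ∀ ξ, HasDerivAt f (f' ξ) ξ) (hf'' : ∀ ξ, HasDerivAt f' (f'' ξ) ξ) :
    Continuous f'' := by
  have h1 : deriv f = f' := funext fun ξ => (hf' ξ).deriv
  have h2 : deriv f' = f'' := funext fun ξ => (hf'' ξ).deriv
  have hcont := hf.continuous_iteratedDeriv 2 (WithTop.coe_le_coe.2 le_top)
  rwa [iteratedDeriv_succ, iteratedDeriv_one, h1, h2] at hcont

theorem weak_linear_stability_L2 {N : ℕ} (hN : 0 < N)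
    (Λ : Matrix (Fin N) (Fin N) ℝ) (hΛ : IsUnit Λ)
    (G G' G'' h h' h'' : ℝ → Matrix (Fin N) (Fin N) ℝ)
    (hGsmooth : ∀ i j, ContDiff ℝ (⊤ : ℕ∞) fun ξ => G ξ i j)
    (hGderiv : ∀ ξ i j, HasDerivAt (fun t => G t i j) (G' ξ i j) ξ)
    (hGderiv2 : ∀ ξ i j, HasDerivAt (fun t => G' t i j) (G'' ξ i j) ξ)
    (hGpos : ∀ ξ, (G ξ).PosDef)
    (hHE : ∀ ξ, G'' ξ = G' ξ * (G ξ)⁻¹ * G' ξ)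
    (hGbc : holBC Λ G) (hG'bc : holBC Λ G')
    (hhsmooth : ∀ i j, ContDiff ℝ (⊤ : ℕ∞) fun ξ => h ξ i j)
    (hhderiv : ∀ ξ i j, HasDerivAt (fun t => h t i j) (h' ξ i j) ξ)
    (hhderiv2 : ∀ ξ i j, HasDerivAt (fun t => h' t i j) (h'' ξ i j) ξ)
    (hhsymm : ∀ ξ, (h ξ).IsSymm)
    (hhbc : holBC Λ h) (hh'bc : holBC Λ h') :
    (∫ ξ in (0:ℝ)..1, innerG (G ξ) (L2 G G' h h' h'' ξ) (h ξ)) ≤ 0 ∧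
      ((∫ ξ in (0:ℝ)..1, innerG (G ξ) (L2 G G' h h' h'' ξ) (h ξ)) = 0 ↔
        ∀ ξ ∈ Set.Icc (0:ℝ) 1, (G ξ)⁻¹ * h ξ = (G 0)⁻¹ * h 0) := by
  have hG1 ξ : HasDerivAt G (G' ξ) ξ := hasDerivAt_matrix (hGderiv ξ)
  have hG2 ξ : HasDerivAt G' (G'' ξ) ξ := hasDerivAt_matrix (hGderiv2 ξ)
  have hh1 ξ : HasDerivAt h (h' ξ) ξ := hasDerivAt_matrix (hhderiv ξ)
  have hh2 ξ : HasDerivAt h' (h'' ξ) ξ := hasDerivAt_matrix (hhderiv2 ξ)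
  have hcG' : Continuous G' :=
    continuous_iff_continuousAt.2 fun ξ => (hG2 ξ).matrix_continuousAt
  have hcinv : Continuous fun ξ => (G ξ)⁻¹ := continuous_iff_continuousAt.2 fun ξ =>
    ((hG1 ξ).matrix_inv (hGpos ξ).isUnit).matrix_continuousAt
  have hch : Continuous h := continuous_iff_continuousAt.2 fun ξ => (hh1 ξ).matrix_continuousAt
  have hch' : Continuous h' :=
    continuous_iff_continuousAt.2 fun ξ => (hh2 ξ).matrix_continuousAt
  have hch'' : Continuous h'' := continuous_matrix fun i j =>
    continuous_second_deriv (hhsmooth i j) (fun ξ => hhderiv ξ i j) fun ξ => hhderiv2 ξ i j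
  have hcL : Continuous (L2 G G' h h' h'') :=
    ((hch''.sub ((hch'.matrix_mul hcinv).matrix_mul hcG')).sub
      ((hcG'.matrix_mul hcinv).matrix_mul hch')).add
      ((((hcG'.matrix_mul hcinv).matrix_mul hch).matrix_mul hcinv).matrix_mul hcG')
  have hck : Continuous (covDeriv G G' h h') :=
    hch'.sub ((hcG'.matrix_mul hcinv).matrix_mul hch)
  have hcLh := continuous_innerG hcinv hcL hch
  have hckk := continuous_innerG hcinv hck hck
  have hkbc : covDeriv G G' h h' 1 = Λᵀ * covDeriv G G' h h' 0 * Λ := by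
    have hd : IsUnit Λ.det := (Matrix.isUnit_iff_isUnit_det Λ).1 hΛ
    have hdt : IsUnit Λᵀ.det := by rwa [Matrix.det_transpose]
    rw [holBC] at hGbc hG'bc hhbc hh'bc
    simp only [covDeriv, hGbc, hG'bc, hhbc, hh'bc, Matrix.mul_inv_rev, Matrix.mul_assoc,
      Matrix.nonsing_inv_mul_cancel_left _ _ hdt, Matrix.mul_nonsing_inv_cancel_left _ _ hd,
      Matrix.mul_sub, Matrix.sub_mul]
  have hint : ∫ ξ in (0:ℝ)..1, innerG (G ξ) (L2 G G' h h' h'' ξ) (h ξ)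
      = -∫ ξ in (0:ℝ)..1, innerG (G ξ) (covDeriv G G' h h' ξ) (covDeriv G G' h h' ξ) := by
    have hftc := intervalIntegral.integral_eq_sub_of_hasDerivAt (a := 0) (b := 1)
      (fun ξ _ => hasDerivAt_innerG_covDeriv (hG1 ξ) (hG2 ξ) hGpos (hHE ξ) (hh1 ξ) (hh2 ξ) hhsymm)
      ((hcLh.add hckk).intervalIntegrable 0 1)
    rw [intervalIntegral.integral_add (hcLh.intervalIntegrable 0 1)
      (hckk.intervalIntegrable 0 1), hkbc, show G 1 = _ from hGbc, show h 1 = _ from hhbc,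
      innerG_congr hΛ, sub_self] at hftc
    exact eq_neg_of_add_eq_zero_left hftc
  have hnonneg ξ := innerG_self_nonneg (hGpos ξ) (covDeriv G G' h h' ξ)
  rw [hint, neg_nonpos, neg_eq_zero]
  refine ⟨intervalIntegral.integral_nonneg zero_le_one fun ξ _ => hnonneg ξ, ?_⟩
  rw [matrix_const_on_Icc_iff fun ξ => hasDerivAt_inv_mul (hG1 ξ) (hGpos ξ) (hh1 ξ)]
  simp only [(hGpos _).inv.isUnit.mul_right_eq_zero]
  constructor
  · intro hzero ξ hξ
    by_contra hne
    refine (intervalIntegral.integral_pos zero_lt_one hckk.continuousOn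
      (fun t _ => hnonneg t) ⟨ξ, hξ, ?_⟩).ne' hzero
    exact (hnonneg ξ).lt_of_ne' (mt (innerG_self_eq_zero (hGpos ξ)).1 hne)
  · intro hzero
    refine intervalIntegral.integral_zero_ae (.of_forall fun ξ hξ => ?_)
    rw [Set.uIoc_of_le zero_le_one] at hξ
    exact (innerG_self_eq_zero (hGpos ξ)).2 (hzero ξ (Set.Ioc_subset_Icc_self hξ))
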